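/- Let f : V₀ → ℝ be continuous such that every point of Γ_f lies on a horizontal line contained in Γ_f, and let E = {(x,y,z) ∈ ℝ³ : y > f(x, 0, z − xy/2)} be the epigraph of f. Then there exist θ ∈ ℝ and u ∈ [0, ∞] such that s_{1/t}(E) converges locally in measure to rot_θ(BP_u⁺) as t → ∞; that is, for every compact Q ⊂ ℝ³, the Lebesgue measure of (s_{1/t}(E) △ rot_θ(BP_u⁺)) ∩ Q tends to 0 as t → ∞. Here s_r(x,y,z) = (rx, ry, r²z) for r > 0; rot_θ(x,y,z) = (x·cos θ − y·sin θ, x·sin θ + y·cos θ, z); BP_u⁺ = {(x,y,z) : (z > 0 and y > −u·x) or (z < 0 and y > u·x)} for u ∈ [0,∞); and BP_∞⁺ = {(x,y,z) : x·z > 0}. △ denotes symmetric difference of sets. -/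

import Mathlib

open MeasureTheory Filter

noncomputable section

/-- The Heisenberg group, identified with `ℝ³`. -/
abbrev H : Type := ℝ × ℝ × ℝ

/-- Heisenberg group multiplication. -/
def Hmul (p q : H) : H :=
  (p.1 + q.1, p.2.1 + q.2.1, p.2.2 + q.2.2 + (p.1 * q.2.1 - p.2.1 * q.1) / 2)

/-- The intrinsic projection `Π : ℍ → V₀`. -/
def Proj (p : H) : H := (p.1, 0, p.2.2 - p.1 * p.2.1 / 2)

/-- The `xz`-plane `V₀`. -/
def V0 : Set H := {p : H | p.2.1 = 0}

/-- The intrinsic graph of `f` over `D ⊆ V₀`. -/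
def IGraph (D : Set H) (f : H → ℝ) : Set H :=
  {q : H | ∃ x z : ℝ, ((x, (0 : ℝ), z) ∈ D) ∧
    q = (x, f (x, 0, z), z + x * f (x, 0, z) / 2)}

/-- The horizontal line through `p` with direction `(a, b, 0)`. -/
def horizLineGen (p : H) (a b : ℝ) : Set H := {q : H | ∃ t : ℝ, q = Hmul p (t * a, t * b, 0)}

/-- Every point of `S` lies on a horizontal line contained in `S`. -/
def IsRuled (S : Set H) : Prop :=
  ∀ p ∈ S, ∃ q : H, ∃ a b : ℝ, (a, b) ≠ ((0 : ℝ), (0 : ℝ)) ∧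
    p ∈ horizLineGen q a b ∧ horizLineGen q a b ⊆ S

/-- The scaling automorphism `s_r(x,y,z) = (rx, ry, r²z)`. -/
def sScale (r : ℝ) (p : H) : H := (r * p.1, r * p.2.1, r ^ 2 * p.2.2)

/-- Rotation by `θ` around the `z`-axis. -/
def rotH (θ : ℝ) (p : H) : H :=
  (p.1 * Real.cos θ - p.2.1 * Real.sin θ, p.1 * Real.sin θ + p.2.1 * Real.cos θ, p.2.2)

/-- The epigraph of the broken plane `BP_u` for `u ∈ [0, ∞)`. -/
def BPplus (u : ℝ) : Set H :=
  {p : H | (0 < p.2.2 ∧ p.2.1 > -u * p.1) ∨ (p.2.2 < 0 ∧ p.2.1 > u * p.1)}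

/-- The epigraph of the broken plane `BP_∞`. -/
def BPplusInf : Set H := {p : H | 0 < p.1 * p.2.2}

/-- A quadratic polynomial without simple real roots has nonpositive discriminant. -/
lemma sq_le_of_no_simple_root {a b c : ℝ}
    (h : ∀ x : ℝ, a * x ^ 2 + b * x + c = 0 → 2 * a * x + b = 0) : b ^ 2 ≤ 4 * a * c := by
  by_contra! hlt
  rcases eq_or_ne a 0 with rfl | ha
  · have hb : b ≠ 0 := by
      rintro rfl
      simp at hlt
    have := h (-c / b) (by field_simp; ring)
    simp at this
    exact hb this
  · set s := √(b ^ 2 - 4 * a * c)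
    have hs : 0 < s := Real.sqrt_pos.2 (by linarith)
    have hs2 : s ^ 2 = b ^ 2 - 4 * a * c := Real.sq_sqrt (by linarith)
    have := h ((-b + s) / (2 * a)) (by field_simp; nlinarith)
    field_simp at this
    linarith

/-- The parabola `a x² + b x + c` is a ruling for the slope field `F`. -/
def IsRuling (F : ℝ → ℝ → ℝ) (a b c : ℝ) : Prop :=
  ∀ x, F x (a * x ^ 2 + b * x + c) = 2 * a * x + b

lemma IsRuling.neg {F : ℝ → ℝ → ℝ} {a b c : ℝ} (h : IsRuling F a b c) :
    IsRuling (fun x w => -F x (-w)) (-a) (-b) (-c) := by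
  intro x
  have := h x
  change -F x (-(-a * x ^ 2 + -b * x + -c)) = _
  rw [show -(-a * x ^ 2 + -b * x + -c) = a * x ^ 2 + b * x + c by ring, this]
  ring

/-- Two rulings of the same slope field do not cross. -/
lemma IsRuling.sq_le {F : ℝ → ℝ → ℝ} {a b c a₁ b₁ c₁ : ℝ} (h : IsRuling F a b c)
    (h₁ : IsRuling F a₁ b₁ c₁) : (b - b₁) ^ 2 ≤ 4 * (a - a₁) * (c - c₁) := by
  refine sq_le_of_no_simple_root fun x hx => ?_
  have e : a * x ^ 2 + b * x + c = a₁ * x ^ 2 + b₁ * x + c₁ := by linarith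
  have := h x
  rw [e, h₁ x] at this
  linarith

lemma IsRuling.sq_le_scaled {F : ℝ → ℝ → ℝ} {a b c a₁ b₁ c₁ t : ℝ} (ht : 0 < t)
    (h : IsRuling F a (t * b) (t ^ 2 * c)) (h₁ : IsRuling F a₁ b₁ c₁) :
    (b - b₁ / t) ^ 2 ≤ 4 * (a - a₁) * (c - c₁ / t ^ 2) := by
  have := h.sq_le h₁
  have e1 : t * b - b₁ = t * (b - b₁ / t) := by field_simp
  have e2 : t ^ 2 * c - c₁ = t ^ 2 * (c - c₁ / t ^ 2) := by field_simp
  rw [e1, e2] at this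
  have ht2 : 0 < t ^ 2 := by positivity
  refine le_of_mul_le_mul_left ?_ ht2
  linarith

lemma eventually_abs_div_lt (b : ℝ) {η : ℝ} (hη : 0 < η) : ∀ᶠ t : ℝ in atTop, |b / t| < η := by
  have h : Tendsto (fun t : ℝ => b / t) atTop (nhds 0) := tendsto_const_nhds.div_atTop tendsto_id
  have := h.abs
  rw [abs_zero] at this
  exact this.eventually (gt_mem_nhds hη)

lemma eventually_abs_div_sq_lt (c : ℝ) {η : ℝ} (hη : 0 < η) :
    ∀ᶠ t : ℝ in atTop, |c / t ^ 2| < η := by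
  have h : Tendsto (fun t : ℝ => c / t ^ 2) atTop (nhds 0) :=
    tendsto_const_nhds.div_atTop (tendsto_pow_atTop two_ne_zero)
  have := h.abs
  rw [abs_zero] at this
  exact this.eventually (gt_mem_nhds hη)

lemma exists_pos_forall_lt_of_sq_le {ε M : ℝ} (hε : 0 < ε) (hM : 0 < M) :
    ∃ η : ℝ, 0 < η ∧ η ≤ 1 ∧ ∀ B, B ^ 2 ≤ η * M * (B + 1) → B < ε := by
  have hq : 0 < ε ^ 2 / (2 * M * (ε + 1)) := by positivity
  refine ⟨min 1 (ε ^ 2 / (2 * M * (ε + 1))), lt_min one_pos hq, min_le_left _ _, fun B h => ?_⟩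
  set η := min 1 (ε ^ 2 / (2 * M * (ε + 1)))
  have h1 : η * (2 * M * (ε + 1)) ≤ ε ^ 2 := (le_div_iff₀ (by positivity)).1 (min_le_right _ _)
  by_contra! hB
  have h2 : B ^ 2 * (2 * (ε + 1)) ≤ ε ^ 2 * (B + 1) := by
    have : η * M * (B + 1) * (2 * (ε + 1)) ≤ ε ^ 2 * (B + 1) := by
      have := mul_le_mul_of_nonneg_right h1 (by linarith : 0 ≤ B + 1)
      linarith
    have := mul_le_mul_of_nonneg_right h (by positivity : 0 ≤ 2 * (ε + 1))
    linarith
  have h3 : ε * (B + 1) ≤ B * (ε + 1) := by nlinarith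
  have h4 : ε ^ 2 * (B + 1) ≤ B ^ 2 * (ε + 1) := by
    have : ε * (ε * (B + 1)) ≤ B * (B * (ε + 1)) :=
      mul_le_mul hB h3 (by nlinarith) (by linarith)
    nlinarith
  have : 0 < B ^ 2 * (ε + 1) := by
    have : 0 < B := hε.trans_le hB
    positivity
  linarith

/-- Rulings of bounded curvature close to a reference curvature have small linear part. -/
lemma exists_pos_abs_lt_of_curvature_close (A x w : ℝ) {ε : ℝ} (hε : 0 < ε) :
    ∃ η : ℝ, 0 < η ∧ η ≤ 1 ∧ ∀ a b c a₁ e g : ℝ, A - η ≤ a₁ → a₁ ≤ a → a ≤ A → |e| < η →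
      |g| < η → g < c → (b - e) ^ 2 ≤ 4 * (a - a₁) * (c - g) →
      a * x ^ 2 + b * x + c = w → |b| < ε := by
  set K := |w| + (|A| + 1) * x ^ 2 + 1
  have hK : 0 < K := by positivity
  obtain ⟨η, hη, hη1, h⟩ := exists_pos_forall_lt_of_sq_le (M := 2 + 4 * K + 4 * |x|) hε
    (by positivity)
  refine ⟨η, hη, hη1, fun a b c a₁ e g h1 h2 h3 he hg hgc hsq heq => h _ ?_⟩
  have hc : c - g ≤ K + |b| * |x| := by
    have h5 : -(b * x) ≤ |b| * |x| := by rw [← abs_mul]; exact neg_le_abs _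
    have h6 : -a * x ^ 2 ≤ (|A| + 1) * x ^ 2 := by
      have := neg_abs_le A
      gcongr
      linarith
    have := le_abs_self w
    have := (abs_lt.1 hg).1
    simp only [K]
    linarith
  have h7 : 4 * (a - a₁) * (c - g) ≤ 4 * η * (K + |b| * |x|) := by
    have : 0 ≤ c - g := by linarith
    gcongr
    linarith
  have h8 : b * e ≤ |b| * η := by
    refine (le_abs_self _).trans ?_
    rw [abs_mul]
    gcongr
  have h9 := sq_abs b
  have : 0 ≤ η * |x| := by positivity
  have : 0 ≤ η * (K * |b|) := by positivity
  nlinarith [sq_nonneg e]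

lemma exists_pos_abs_lt_of_height_small (a₀ w : ℝ) {x ε : ℝ} (hx : x ≠ 0) (hε : 0 < ε) :
    ∃ η : ℝ, 0 < η ∧ η ≤ 1 ∧ ∀ a b c e : ℝ, |e| < η → |c| ≤ η →
      (b - e) ^ 2 ≤ 4 * (a - a₀) * c → a * x ^ 2 + b * x + c = w → |b| < ε := by
  have hx2 : 0 < x ^ 2 := by positivity
  set K := |a₀| + (|w| + 1) / x ^ 2
  have hK : 0 ≤ K := by positivity
  obtain ⟨η, hη, hη1, h⟩ := exists_pos_forall_lt_of_sq_le (M := 2 + 4 * K + 4 * (|x| / x ^ 2)) hε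
    (by positivity)
  refine ⟨η, hη, hη1, fun a b c e he hc hsq heq => h _ ?_⟩
  have ha : |a - a₀| ≤ K + |b| * (|x| / x ^ 2) := by
    have h1 : |a| ≤ (|w| + 1) / x ^ 2 + |b| * (|x| / x ^ 2) := by
      rw [← mul_div_assoc, ← add_div, le_div_iff₀ hx2]
      calc |a| * x ^ 2 = |w - b * x - c| := by
            rw [show w - b * x - c = a * x ^ 2 by linarith, abs_mul, abs_of_pos hx2]
        _ ≤ |w| + |b * x| + |c| := (abs_sub _ _).trans (add_le_add_left (abs_sub _ _) _)
        _ ≤ _ := by rw [abs_mul]; linarith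
    have := abs_sub a a₀
    simp only [K]
    linarith
  have h7 : 4 * (a - a₀) * c ≤ 4 * η * (K + |b| * (|x| / x ^ 2)) := by
    have h1 : (a - a₀) * c ≤ |a - a₀| * |c| := by rw [← abs_mul]; exact le_abs_self _
    have h2 : |a - a₀| * |c| ≤ (K + |b| * (|x| / x ^ 2)) * η := by gcongr
    linarith
  have h8 : b * e ≤ |b| * η := by
    refine (le_abs_self _).trans ?_
    rw [abs_mul]
    gcongr
  have h9 := sq_abs b
  have : 0 ≤ η * (|x| / x ^ 2) := by positivity
  have : 0 ≤ η * (K * |b|) := by positivity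
  nlinarith [sq_nonneg e]

lemma eventually_pos_of_height_neg {F : ℝ → ℝ → ℝ} {x y z δ a₀ b₀ c₀ : ℝ} (hx : x ≠ 0)
    (hz : 0 < z) (hδ : 0 < δ) (h₀ : IsRuling F a₀ b₀ c₀) :
    ∀ᶠ t : ℝ in atTop, ∀ a b c : ℝ, IsRuling F a (t * b) (t ^ 2 * c) →
      a * x ^ 2 + b * x + c = z - x * y / 2 → c ≤ -δ → |b * x| < z - c := by
  have hx2 : 0 < x ^ 2 := by positivity
  by_cases hbdd : BddBelow {a | ∃ b c, IsRuling F a b c}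
  · set A := sInf {a | ∃ b c, IsRuling F a b c}
    obtain ⟨a₁, ⟨b₁, c₁, h₁⟩, ha₁⟩ := exists_lt_of_csInf_lt
      (s := {a | ∃ b c, IsRuling F a b c}) ⟨a₀, b₀, c₀, h₀⟩
      (show A < A + z / (4 * x ^ 2) by linarith [show 0 < z / (4 * x ^ 2) by positivity])
    filter_upwards [eventually_gt_atTop 0, eventually_abs_div_lt b₁ (η := z / (2 * |x|))
      (by positivity), eventually_abs_div_sq_lt c₁ (η := min δ (z / 4)) (by positivity)]
      with t ht he hg a b c h heq hc
    have hsq := h.sq_le_scaled ht h₁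
    set e := b₁ / t
    set g := c₁ / t ^ 2
    have haA : A ≤ a := csInf_le hbdd ⟨_, _, h⟩
    have hgδ := abs_lt.1 (hg.trans_le (min_le_left _ _))
    have hgz := abs_lt.1 (hg.trans_le (min_le_right _ _))
    have h3 : 4 * (a - a₁) * (c - g) ≤ 4 * (z / (4 * x ^ 2)) * (g - c) := by
      have : 0 ≤ g - c := by linarith
      have : (a₁ - a) * (g - c) ≤ (z / (4 * x ^ 2)) * (g - c) := by
        gcongr
        linarith
      linarith
    have h4 : ((b - e) * x) ^ 2 ≤ z * (g - c) := by
      calc ((b - e) * x) ^ 2 = (b - e) ^ 2 * x ^ 2 := by ring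
        _ ≤ (4 * (z / (4 * x ^ 2)) * (g - c)) * x ^ 2 := by gcongr; exact hsq.trans h3
        _ = _ := by field_simp
    have h5 : |e * x| < z / 2 := by
      rw [abs_mul]
      calc |e| * |x| < z / (2 * |x|) * |x| := by gcongr
        _ = z / 2 := by field_simp
    have h6 : |(b - e) * x| < z / 2 - c := by
      refine abs_lt_of_sq_lt_sq ?_ (by linarith)
      nlinarith
    calc |b * x| = |(b - e) * x + e * x| := by congr 1; ring
      _ ≤ _ := abs_add_le _ _
      _ < _ := by linarith
  · rw [not_bddBelow_iff] at hbdd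
    obtain ⟨a₁, ⟨b₁, c₁, h₁⟩, ha₁⟩ := hbdd ((z - x * y / 2 - 1) / x ^ 2)
    rw [lt_div_iff₀ hx2] at ha₁
    filter_upwards [eventually_gt_atTop 0, eventually_abs_div_lt b₁ (η := 1 / (2 * |x|))
      (by positivity), eventually_abs_div_sq_lt c₁ (η := min δ (1 / 2)) (by positivity)]
      with t ht he hg a b c h heq hc
    exfalso
    have hsq := h.sq_le_scaled ht h₁
    set e := b₁ / t
    set g := c₁ / t ^ 2
    have hgδ := abs_lt.1 (hg.trans_le (min_le_left _ _))
    have hgz := abs_lt.1 (hg.trans_le (min_le_right _ _))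
    have h5 : |e * x| < 1 / 2 := by
      rw [abs_mul]
      calc |e| * |x| < 1 / (2 * |x|) * |x| := by gcongr
        _ = 1 / 2 := by field_simp
    have h5' := abs_lt.1 h5
    have hgc : 0 < g - c := by linarith
    have h6 : (a₁ - a) * x ^ 2 + (e - b) * x + (g - c) < 0 := by linarith
    have h7 : 0 ≤ 4 * (g - c) * ((a₁ - a) * x ^ 2 + (e - b) * x + (g - c)) := by
      nlinarith [sq_nonneg ((e - b) * x + 2 * (g - c)), mul_le_mul_of_nonneg_right hsq hx2.le]
    nlinarith

lemma exists_eventually_pos_of_height_le {F : ℝ → ℝ → ℝ} {x y z a₀ b₀ : ℝ} (hx : x ≠ 0)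
    (hz : 0 < z) (h₀ : IsRuling F a₀ b₀ 0) :
    ∃ δ : ℝ, 0 < δ ∧ ∀ᶠ t : ℝ in atTop, ∀ a b c : ℝ, IsRuling F a (t * b) (t ^ 2 * c) →
      a * x ^ 2 + b * x + c = z - x * y / 2 → c ≤ δ →
      0 < x * (2 * a * x + b + y) ∧ 0 < x * (2 * a * x + y) := by
  obtain ⟨η, hη, -, hη'⟩ := exists_pos_abs_lt_of_height_small a₀ (z - x * y / 2) hx
    (ε := z / (2 * |x|)) (by positivity)
  have hδ : 0 < min η (z / 4) := by positivity
  refine ⟨_, hδ, ?_⟩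
  filter_upwards [eventually_gt_atTop 0, eventually_abs_div_lt b₀ hη,
    eventually_pos_of_height_neg (y := y) hx hz hδ h₀] with t ht he hneg a b c h heq hc
  have key : |b * x| < z - c := by
    rcases le_total c (-min η (z / 4)) with hc' | hc'
    · exact hneg a b c h heq hc'
    · have hsq := h.sq_le_scaled ht h₀
      rw [zero_div, sub_zero] at hsq
      have hb := hη' a b c _ he (abs_le.2 ⟨by linarith [min_le_left η (z / 4)],
        hc.trans (min_le_left _ _)⟩) hsq heq
      have : |b * x| < z / 2 := by
        rw [abs_mul]
        calc |b| * |x| < z / (2 * |x|) * |x| := by gcongr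
          _ = z / 2 := by field_simp
      linarith [min_le_right η (z / 4)]
  have := abs_lt.1 key
  constructor <;> nlinarith

lemma eventually_abs_sub_lt_of_height_ge {F : ℝ → ℝ → ℝ} {x w δ ε : ℝ} (hδ : 0 < δ) (hε : 0 < ε)
    (hne : {a | ∃ b c, IsRuling F a b c}.Nonempty) (hbdd : BddAbove {a | ∃ b c, IsRuling F a b c}) :
    ∀ᶠ t : ℝ in atTop, ∀ a b c : ℝ, IsRuling F a (t * b) (t ^ 2 * c) →
      a * x ^ 2 + b * x + c = w → δ ≤ c →
      |2 * a * x + b - 2 * sSup {a | ∃ b c, IsRuling F a b c} * x| < ε := by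
  set A := sSup {a | ∃ b c, IsRuling F a b c}
  obtain ⟨η, hη, -, h'⟩ := exists_pos_abs_lt_of_curvature_close A x w (ε := ε / 2) (by positivity)
  set κ := min η (ε / (4 * (|x| + 1)))
  have hκ : 0 < κ := by positivity
  obtain ⟨a₁, ⟨b₁, c₁, h₁⟩, ha₁⟩ := exists_lt_of_lt_csSup hne (show A - κ < A by linarith)
  filter_upwards [eventually_gt_atTop 0, eventually_abs_div_lt b₁ hη,
    eventually_abs_div_sq_lt c₁ (η := min δ η) (by positivity)] with t ht he hg a b c h heq hc
  have hsq := h.sq_le_scaled ht h₁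
  have hgδ := abs_lt.1 (hg.trans_le (min_le_left _ _))
  have hgc : 0 < c - c₁ / t ^ 2 := by linarith
  have ha : a₁ ≤ a := by
    by_contra! hlt
    have := mul_pos (sub_pos.2 hlt) hgc
    nlinarith [sq_nonneg (b - b₁ / t)]
  have haA : a ≤ A := le_csSup hbdd ⟨_, _, h⟩
  have hb := h' a b c a₁ _ _ (by linarith [min_le_left η (ε / (4 * (|x| + 1)))]) ha haA he
    (hg.trans_le (min_le_right _ _)) (by linarith) hsq heq
  have h2 : |2 * (a - A) * x| ≤ ε / 2 := by
    rw [abs_mul, abs_mul, abs_two, abs_of_nonpos (by linarith)]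
    have h3 : κ * (4 * (|x| + 1)) ≤ ε := (le_div_iff₀ (by positivity)).1 (min_le_right _ _)
    have : (-(a - A)) * |x| ≤ κ * |x| := by gcongr; linarith
    linarith
  calc |2 * a * x + b - 2 * A * x| = |2 * (a - A) * x + b| := by congr 1; ring
    _ ≤ _ := abs_add_le _ _
    _ < _ := by linarith

lemma eventually_height_lt_of_not_bddAbove {F : ℝ → ℝ → ℝ} {x w δ : ℝ} (hx : x ≠ 0) (hδ : 0 < δ)
    (hbdd : ¬ BddAbove {a | ∃ b c, IsRuling F a b c}) :
    ∀ᶠ t : ℝ in atTop, ∀ a b c : ℝ, IsRuling F a (t * b) (t ^ 2 * c) →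
      a * x ^ 2 + b * x + c = w → c < δ := by
  have hx2 : 0 < x ^ 2 := by positivity
  rw [not_bddAbove_iff] at hbdd
  obtain ⟨a₁, ⟨b₁, c₁, h₁⟩, ha₁⟩ := hbdd ((w + 1) / x ^ 2)
  rw [div_lt_iff₀ hx2] at ha₁
  filter_upwards [eventually_gt_atTop 0, eventually_abs_div_lt b₁ (η := 1 / (2 * |x|))
    (by positivity), eventually_abs_div_sq_lt c₁ (η := min δ (1 / 2)) (by positivity)]
    with t ht he hg a b c h heq
  by_contra! hc
  have hsq := h.sq_le_scaled ht h₁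
  set e := b₁ / t
  set g := c₁ / t ^ 2
  have hgδ := abs_lt.1 (hg.trans_le (min_le_left _ _))
  have hgz := abs_lt.1 (hg.trans_le (min_le_right _ _))
  have h5 : |e * x| < 1 / 2 := by
    rw [abs_mul]
    calc |e| * |x| < 1 / (2 * |x|) * |x| := by gcongr
      _ = 1 / 2 := by field_simp
  have h5' := abs_lt.1 h5
  have hgc : 0 < c - g := by linarith
  have h6 : (a - a₁) * x ^ 2 + (b - e) * x + (c - g) < 0 := by linarith
  have h7 : 0 ≤ 4 * (c - g) * ((a - a₁) * x ^ 2 + (b - e) * x + (c - g)) := by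
    nlinarith [sq_nonneg ((b - e) * x + 2 * (c - g)), mul_le_mul_of_nonneg_right hsq hx2.le]
  nlinarith

lemma mul_pos_of_mul_pos_mul_pos {x D L : ℝ} (hD : 0 < x * D) (hL : 0 < x * L) : 0 < D * L := by
  have : 0 < x ^ 2 * (D * L) := by linarith [mul_pos hD hL]
  exact pos_of_mul_pos_right this (sq_nonneg x)

/-- Asymptotically, the slope field `F` is compared with `-y` on the half space `z > 0` by a
half plane with inner normal `(sin ψ, cos ψ)`. -/
lemma exists_limit_angle {F : ℝ → ℝ → ℝ}
    (hF : ∀ x w, ∃ a b c, IsRuling F a b c ∧ a * x ^ 2 + b * x + c = w) :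
    ∃ ψ : ℝ, ψ ≤ Real.pi / 2 ∧ (∀ a b c, IsRuling F a b c → Real.arctan (2 * a) ≤ ψ) ∧
      ∀ x y z : ℝ, x ≠ 0 → 0 < z → x * Real.sin ψ + y * Real.cos ψ ≠ 0 →
        ∀ᶠ t : ℝ in atTop, 0 < (F (t * x) (t ^ 2 * (z - x * y / 2)) + t * y) *
          (x * Real.sin ψ + y * Real.cos ψ) := by
  obtain ⟨a₀, b₀, c₀, h₀, hc₀⟩ := hF 0 0
  obtain rfl : c₀ = 0 := by simpa using hc₀
  have hne : {a | ∃ b c, IsRuling F a b c}.Nonempty := ⟨a₀, b₀, 0, h₀⟩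
  have reduce : ∀ (x y z L : ℝ),
      (∀ᶠ t : ℝ in atTop, ∀ a b c : ℝ, IsRuling F a (t * b) (t ^ 2 * c) →
        a * x ^ 2 + b * x + c = z - x * y / 2 → 0 < (2 * a * x + b + y) * L) →
      ∀ᶠ t : ℝ in atTop, 0 < (F (t * x) (t ^ 2 * (z - x * y / 2)) + t * y) * L := by
    intro x y z L h
    filter_upwards [h, eventually_gt_atTop 0] with t h ht
    obtain ⟨a, b, c, hr, heq⟩ := hF (t * x) (t ^ 2 * (z - x * y / 2))
    have e1 : t * (b / t) = b := by field_simp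
    have e2 : t ^ 2 * (c / t ^ 2) = c := by field_simp
    have hL := h a (b / t) (c / t ^ 2) (by rwa [e1, e2]) (by
      field_simp
      linarith)
    rw [← heq, hr, show 2 * a * (t * x) + b + t * y = t * (2 * a * x + b / t + y) by field_simp,
      mul_assoc]
    exact mul_pos ht hL
  by_cases hbdd : BddAbove {a | ∃ b c, IsRuling F a b c}
  · set A := sSup {a | ∃ b c, IsRuling F a b c} with hA
    refine ⟨Real.arctan (2 * A), (Real.arctan_lt_pi_div_two _).le, fun a b c h =>
      Real.arctan_strictMono.monotone (by linarith [le_csSup hbdd ⟨b, c, h⟩]),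
      fun x y z hx hz hL => reduce _ _ _ _ ?_⟩
    have hcos := Real.cos_arctan_pos (2 * A)
    have hL' : x * Real.sin (Real.arctan (2 * A)) + y * Real.cos (Real.arctan (2 * A)) =
        Real.cos (Real.arctan (2 * A)) * (2 * A * x + y) := by
      have := Real.tan_mul_cos hcos.ne'
      rw [Real.tan_arctan] at this
      rw [← this]
      ring
    rw [hL'] at hL ⊢
    have hL0 : 2 * A * x + y ≠ 0 := right_ne_zero_of_mul hL
    obtain ⟨δ, hδ, hlow⟩ := exists_eventually_pos_of_height_le (y := y) hx hz h₀
    filter_upwards [hlow, eventually_abs_sub_lt_of_height_ge (x := x) (w := z - x * y / 2) hδ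
      (abs_pos.2 hL0) hne hbdd] with t hlow hhigh a b c h heq
    rw [mul_left_comm]
    refine mul_pos hcos ?_
    rcases le_total c δ with hc | hc
    · obtain ⟨h1, h2⟩ := hlow a b c h heq hc
      refine mul_pos_of_mul_pos_mul_pos h1 ?_
      have : a ≤ A := le_csSup hbdd ⟨_, _, h⟩
      nlinarith [mul_le_mul_of_nonneg_right this (sq_nonneg x)]
    · have := hhigh a b c h heq hc
      rw [← hA] at this
      have h3 := abs_lt.1 this
      rcases lt_or_gt_of_ne hL0 with hneg | hpos
      · rw [abs_of_neg hneg] at h3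
        exact mul_pos_of_neg_of_neg (by linarith) hneg
      · rw [abs_of_pos hpos] at h3
        exact mul_pos (by linarith) hpos
  · refine ⟨Real.pi / 2, le_rfl, fun a b c _ => (Real.arctan_lt_pi_div_two _).le,
      fun x y z hx hz hL => reduce _ _ _ _ ?_⟩
    rw [Real.sin_pi_div_two, Real.cos_pi_div_two, mul_zero, mul_one, add_zero]
    obtain ⟨δ, hδ, hlow⟩ := exists_eventually_pos_of_height_le (y := y) hx hz h₀
    filter_upwards [hlow, eventually_height_lt_of_not_bddAbove (w := z - x * y / 2) hx hδ hbdd]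
      with t hlow hhigh a b c h heq
    exact mul_pos_of_mul_pos_mul_pos (hlow a b c h heq (hhigh a b c h heq).le).1
      (mul_self_pos.2 hx)

/-- Through every point of `V₀` passes a ruling, the projection of a horizontal line. -/
lemma exists_isRuling_of_isRuled {f : H → ℝ} (h : IsRuled (IGraph V0 f)) (x w : ℝ) :
    ∃ a b c, IsRuling (fun x w => -f (x, 0, w)) a b c ∧ a * x ^ 2 + b * x + c = w := by
  obtain ⟨⟨q₁, q₂, q₃⟩, a, b, hab, ⟨t₀, ht₀⟩, hsub⟩ := h _ ⟨x, w, rfl, rfl⟩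
  simp only [Hmul, Prod.mk.injEq] at ht₀
  obtain ⟨hx, hy, hz⟩ := ht₀
  have hline : ∀ t : ℝ, f (q₁ + t * a, 0,
      q₃ + (q₁ * (t * b) - q₂ * (t * a)) / 2 - (q₁ + t * a) * (q₂ + t * b) / 2) = q₂ + t * b := by
    intro t
    obtain ⟨x', z', -, he⟩ := hsub ⟨t, rfl⟩
    simp only [Hmul, Prod.mk.injEq] at he
    obtain ⟨rfl, h2, h3⟩ := he
    rw [h2, show q₃ + (q₁ * (t * b) - q₂ * (t * a)) / 2 -
      (q₁ + t * a) * f (q₁ + t * a, 0, z') / 2 = z' by linarith]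
  have ha : a ≠ 0 := by
    rintro rfl
    have h0 := hline 0
    have h1 := hline 1
    rw [show q₃ + (q₁ * (1 * b) - q₂ * (1 * 0)) / 2 - (q₁ + 1 * 0) * (q₂ + 1 * b) / 2 =
      q₃ + (q₁ * (0 * b) - q₂ * (0 * 0)) / 2 - (q₁ + 0 * 0) * (q₂ + 0 * b) / 2 by ring,
      show q₁ + 1 * (0 : ℝ) = q₁ + 0 * 0 by ring, h0] at h1
    exact hab (by rw [show b = 0 by linarith])
  refine ⟨-(b / a) / 2, q₁ * (b / a) - q₂, q₃ - (q₁ * (b / a) - q₂) * q₁ / 2, fun x => ?_, ?_⟩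
  · have := hline ((x - q₁) / a)
    rw [show q₁ + (x - q₁) / a * a = x by field_simp; ring] at this
    rw [show -(b / a) / 2 * x ^ 2 + (q₁ * (b / a) - q₂) * x +
      (q₃ - (q₁ * (b / a) - q₂) * q₁ / 2) = q₃ + (q₁ * ((x - q₁) / a * b) -
      q₂ * ((x - q₁) / a * a)) / 2 - x * (q₂ + (x - q₁) / a * b) / 2 by field_simp; ring]
    change -f _ = _
    rw [this]
    field_simp
    ring
  · rw [hy] at hz
    have : w = q₃ + 0 + (q₁ * (t₀ * b) - q₂ * (t₀ * a)) / 2 - x * (q₂ + t₀ * b) / 2 := by linarith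
    rw [this, hx]
    field_simp
    ring

/-- The region bounded by two vertical half planes with inner normals `(sin ψ, cos ψ)` above and
`(sin φ, cos φ)` below the plane `z = 0`. -/
def brokenRegion (ψ φ : ℝ) : Set H :=
  {p : H | (0 < p.2.2 ∧ 0 < p.1 * Real.sin ψ + p.2.1 * Real.cos ψ) ∨
    (p.2.2 < 0 ∧ 0 < p.1 * Real.sin φ + p.2.1 * Real.cos φ)}

lemma rotH_rotH_neg (θ : ℝ) (p : H) : rotH θ (rotH (-θ) p) = p := by
  obtain ⟨x, y, z⟩ := p
  have := Real.sin_sq_add_cos_sq θ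
  simp only [rotH, Real.cos_neg, Real.sin_neg, Prod.mk.injEq, and_true]
  constructor
  · linear_combination x * this
  · linear_combination y * this

lemma rotH_image_eq_preimage (θ : ℝ) (B : Set H) : rotH θ '' B = rotH (-θ) ⁻¹' B := by
  refine congrFun (Set.image_eq_preimage_of_inverse (fun p => ?_) (rotH_rotH_neg θ)) B
  simpa using rotH_rotH_neg (-θ) p

lemma rotH_image_brokenRegion (θ ψ φ : ℝ) :
    rotH θ '' brokenRegion ψ φ = brokenRegion (ψ - θ) (φ - θ) := by
  rw [rotH_image_eq_preimage]
  ext ⟨x, y, z⟩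
  simp only [brokenRegion, rotH, Set.mem_preimage, Set.mem_ofPred_eq, Real.cos_neg, Real.sin_neg,
    Real.sin_sub, Real.cos_sub]
  ring_nf

lemma brokenRegion_neg_eq_BPplus {φ : ℝ} (h0 : 0 ≤ φ) (h1 : φ < Real.pi / 2) :
    brokenRegion φ (-φ) = BPplus (Real.tan φ) := by
  have hcos : 0 < Real.cos φ := Real.cos_pos_of_mem_Ioo ⟨by linarith [Real.pi_pos], h1⟩
  ext ⟨x, y, z⟩
  have hs := Real.tan_mul_cos hcos.ne'
  simp only [brokenRegion, BPplus, Set.mem_ofPred_eq, Real.sin_neg, Real.cos_neg, ← hs, gt_iff_lt]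
  rw [show x * (Real.tan φ * Real.cos φ) + y * Real.cos φ =
      Real.cos φ * (y - -Real.tan φ * x) by ring,
    show x * -(Real.tan φ * Real.cos φ) + y * Real.cos φ =
      Real.cos φ * (y - Real.tan φ * x) by ring,
    mul_pos_iff_of_pos_left hcos, mul_pos_iff_of_pos_left hcos, sub_pos, sub_pos]

lemma brokenRegion_pi_div_two :
    brokenRegion (Real.pi / 2) (-(Real.pi / 2)) = BPplusInf := by
  ext ⟨x, y, z⟩
  simp only [brokenRegion, BPplusInf, Set.mem_ofPred_eq, Real.sin_neg, Real.cos_neg,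
    Real.sin_pi_div_two, Real.cos_pi_div_two, mul_pos_iff]
  constructor
  · rintro (⟨h1, h2⟩ | ⟨h1, h2⟩)
    · left; constructor <;> linarith
    · right; constructor <;> linarith
  · rintro (⟨h1, h2⟩ | ⟨h1, h2⟩)
    · left; constructor <;> linarith
    · right; constructor <;> linarith

lemma exists_rotH_image_eq_brokenRegion {ψ φ : ℝ} (hψ : ψ ≤ Real.pi / 2)
    (hφ : -(Real.pi / 2) ≤ φ) (h : φ ≤ ψ) :
    ∃ θ : ℝ, ∃ B : Set H, ((∃ u : ℝ, 0 ≤ u ∧ B = BPplus u) ∨ B = BPplusInf) ∧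
      rotH θ '' B = brokenRegion ψ φ := by
  refine ⟨-(ψ + φ) / 2, brokenRegion ((ψ - φ) / 2) (-((ψ - φ) / 2)), ?_, ?_⟩
  · rcases (show (ψ - φ) / 2 ≤ Real.pi / 2 by linarith).lt_or_eq with hlt | heq
    · exact Or.inl ⟨_, Real.tan_nonneg_of_nonneg_of_le_pi_div_two (by linarith) hlt.le,
        brokenRegion_neg_eq_BPplus (by linarith) hlt⟩
    · right
      rw [heq, brokenRegion_pi_div_two]
  · rw [rotH_image_brokenRegion]
    congr 1 <;> ring

lemma measurableSet_brokenRegion (ψ φ : ℝ) : MeasurableSet (brokenRegion ψ φ) := by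
  have half (g : H → ℝ) (hg : Measurable g) : MeasurableSet {p | 0 < g p} :=
    measurableSet_lt measurable_const hg
  have neg : MeasurableSet {p : H | p.2.2 < 0} :=
    measurableSet_lt (by fun_prop) measurable_const
  exact ((half (fun p => p.2.2) (by fun_prop)).inter
    (half (fun p => p.1 * Real.sin ψ + p.2.1 * Real.cos ψ) (by fun_prop))).union
    (neg.inter (half (fun p => p.1 * Real.sin φ + p.2.1 * Real.cos φ) (by fun_prop)))

lemma ae_linear_ne_zero {a b c : ℝ} (h : a ≠ 0 ∨ b ≠ 0 ∨ c ≠ 0) :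
    ∀ᵐ p : H, p.1 * a + p.2.1 * b + p.2.2 * c ≠ 0 := by
  let L : H →ₗ[ℝ] ℝ :=
    { toFun := fun p => p.1 * a + p.2.1 * b + p.2.2 * c
      map_add' := fun p q => by simp only [Prod.fst_add, Prod.snd_add]; ring
      map_smul' := fun r p => by
        simp only [Prod.smul_fst, Prod.smul_snd, smul_eq_mul, RingHom.id_apply]; ring }
  have hL : LinearMap.ker L ≠ ⊤ := by
    intro htop
    have hz : ∀ p : H, p.1 * a + p.2.1 * b + p.2.2 * c = 0 := fun p =>
      LinearMap.mem_ker.1 (htop ▸ Submodule.mem_top : p ∈ LinearMap.ker L)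
    have h1 := hz (1, 0, 0)
    have h2 := hz (0, 1, 0)
    have h3 := hz (0, 0, 1)
    simp at h1 h2 h3
    simp [h1, h2, h3] at h
  have : (volume : Measure (ℝ × ℝ)).IsAddHaarMeasure :=
    inferInstanceAs ((volume : Measure ℝ).prod (volume : Measure ℝ)).IsAddHaarMeasure
  have : (volume : Measure H).IsAddHaarMeasure :=
    inferInstanceAs ((volume : Measure ℝ).prod (volume : Measure (ℝ × ℝ))).IsAddHaarMeasure
  have := Measure.addHaar_submodule (volume : Measure H) _ hL
  rw [ae_iff]
  convert this using 2
  ext p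
  simp [L]

lemma sin_ne_zero_or_cos_ne_zero (ψ : ℝ) : Real.sin ψ ≠ 0 ∨ Real.cos ψ ≠ 0 := by
  by_contra! h
  have := Real.sin_sq_add_cos_sq ψ
  simp [h.1, h.2] at this

lemma sScale_inv_image_eq_preimage {t : ℝ} (ht : 0 < t) (E : Set H) :
    sScale t⁻¹ '' E = sScale t ⁻¹' E := by
  refine congrFun (Set.image_eq_preimage_of_inverse (fun p => ?_) (fun p => ?_)) E <;>
  · obtain ⟨x, y, z⟩ := p
    simp only [sScale, Prod.mk.injEq]
    refine ⟨?_, ?_, ?_⟩ <;> field_simp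

/-- the scaling limit of the epigraph of a ruled entire intrinsic
graph is (a rotation of) the epigraph of a broken plane `BP_u`, `u ∈ [0, ∞]`:
`s_{1/t}(E)` converges locally in measure to `rot_θ(BP_u⁺)` as `t → ∞`. -/
theorem scaling_limit_is_broken_plane
    (f : H → ℝ) (hf : ContinuousOn f V0)
    (hruled : IsRuled (IGraph V0 f))
    (E : Set H)
    (hE : E = {p : H | p.2.1 > f (p.1, 0, p.2.2 - p.1 * p.2.1 / 2)}) :
    ∃ θ : ℝ, ∃ B : Set H,
      ((∃ u : ℝ, 0 ≤ u ∧ B = BPplus u) ∨ B = BPplusInf) ∧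
      ∀ Q : Set H, IsCompact Q →
        Tendsto
          (fun t : ℝ =>
            volume ((symmDiff (sScale t⁻¹ '' E) (rotH θ '' B)) ∩ Q))
          atTop (nhds 0) := by
  have hcover := exists_isRuling_of_isRuled hruled
  set F : ℝ → ℝ → ℝ := fun x w => -f (x, 0, w) with hFdef
  obtain ⟨ψ, hψ, hψa, hψl⟩ := exists_limit_angle hcover
  obtain ⟨φ, hφ, hφa, hφl⟩ := exists_limit_angle (F := fun x w => -F x (-w)) fun x w => by
    obtain ⟨a, b, c, h, he⟩ := hcover x (-w)
    exact ⟨-a, -b, -c, h.neg, by linarith⟩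
  obtain ⟨a₀, b₀, c₀, h₀, -⟩ := hcover 0 0
  have hle : -φ ≤ ψ := by
    have h1 := hψa _ _ _ h₀
    have h2 := hφa _ _ _ h₀.neg
    rw [mul_neg, Real.arctan_neg] at h2
    linarith
  obtain ⟨θ, B, hB, hrot⟩ := exists_rotH_image_eq_brokenRegion hψ (neg_le_neg hφ) hle
  refine ⟨θ, B, hB, fun Q hQ => ?_⟩
  rw [hrot]
  have hEopen : IsOpen E := by
    have hcont : Continuous fun p : H => f (p.1, 0, p.2.2 - p.1 * p.2.1 / 2) :=
      hf.comp_continuous (by fun_prop) fun p => rfl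
    rw [hE]
    exact isOpen_lt hcont (by fun_prop)
  have hmem : ∀ (t x y z : ℝ), sScale t (x, y, z) ∈ E ↔
      0 < F (t * x) (t ^ 2 * (z - x * y / 2)) + t * y := by
    intro t x y z
    simp only [hE, sScale, Set.mem_ofPred_eq, hFdef, gt_iff_lt]
    rw [show t ^ 2 * z - t * x * (t * y) / 2 = t ^ 2 * (z - x * y / 2) by ring]
    constructor <;> intro h <;> linarith
  have hcongr : (fun t : ℝ => volume (symmDiff (sScale t ⁻¹' E) (brokenRegion ψ (-φ)) ∩ Q))
      =ᶠ[atTop] fun t => volume (symmDiff (sScale t⁻¹ '' E) (brokenRegion ψ (-φ)) ∩ Q) := by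
    filter_upwards [eventually_gt_atTop 0] with t ht
    rw [sScale_inv_image_eq_preimage ht]
  refine Tendsto.congr' hcongr ?_
  rw [← measure_empty (μ := (volume : Measure H))]
  refine tendsto_measure_of_ae_tendsto_indicator atTop MeasurableSet.empty (fun t => ?_)
    hQ.measurableSet hQ.measure_lt_top.ne (.of_forall fun t => Set.inter_subset_right) ?_
  · have hcont : Continuous (sScale t) := by unfold sScale; fun_prop
    exact ((hEopen.preimage hcont).measurableSet.symmDiff
      (measurableSet_brokenRegion _ _)).inter hQ.measurableSet
  · filter_upwards [ae_linear_ne_zero (a := 1) (b := 0) (c := 0) (by simp),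
      ae_linear_ne_zero (a := 0) (b := 0) (c := 1) (by simp),
      ae_linear_ne_zero (a := Real.sin ψ) (b := Real.cos ψ) (c := 0)
        (by simpa using sin_ne_zero_or_cos_ne_zero ψ),
      ae_linear_ne_zero (a := Real.sin (-φ)) (b := Real.cos (-φ)) (c := 0)
        (by simpa using sin_ne_zero_or_cos_ne_zero φ)]
    rintro ⟨x, y, z⟩ hx hz hp hn
    simp only [mul_zero, mul_one, add_zero, zero_add] at hx hz hp hn
    have key : ∀ᶠ t : ℝ in atTop,
        (sScale t (x, y, z) ∈ E ↔ (x, y, z) ∈ brokenRegion ψ (-φ)) := by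
      rcases lt_or_gt_of_ne hz with hz | hz
      · have hn' : x * Real.sin φ + -y * Real.cos φ ≠ 0 := by
          rw [Real.sin_neg, Real.cos_neg] at hn
          contrapose! hn
          linarith
        filter_upwards [hφl x (-y) (-z) hx (by linarith) hn'] with t h
        rw [show -(t ^ 2 * (-z - x * -y / 2)) = t ^ 2 * (z - x * y / 2) by ring,
          show (-F (t * x) (t ^ 2 * (z - x * y / 2)) + t * -y) *
            (x * Real.sin φ + -y * Real.cos φ) = (F (t * x) (t ^ 2 * (z - x * y / 2)) + t * y) *
            (x * Real.sin (-φ) + y * Real.cos (-φ)) by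
              rw [Real.sin_neg, Real.cos_neg]; ring] at h
        rw [hmem, pos_iff_pos_of_mul_pos h]
        simp [brokenRegion, hz, hz.not_gt]
      · filter_upwards [hψl x y z hx hz hp] with t h
        rw [hmem, pos_iff_pos_of_mul_pos h]
        simp [brokenRegion, hz, hz.not_gt]
    filter_upwards [key] with t h
    simp only [Set.mem_inter_iff, Set.mem_symmDiff, Set.mem_preimage, Set.mem_empty_iff_false,
      iff_false]
    tauto
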